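/- arXiv:1401.0645 — 2 statements merged into one kernel-verified Lean document; each statement's English description precedes it below -/
import Mathlib

section
/- Let n ≥ 2 and d ≥ 1, let A be a set of m nonzero polynomials in ℤ[x_1,…,x_n], each of degree at most d in every variable, and let E = {f} ⊆ A be a singleton with f of positive degree in x_n. Then for any irreducible basis B for the primitive parts of A and any irreducible basis F ⊆ B for the primitive parts of E, the reduced projection P_E(A) has the (M, 2d²)-property with M = ⌊(3m+1)/2⌋. -/
open Polynomial
open scoped Classical

noncomputable section

/-- `Rk k` is the coefficient ring `ℤ[x_1,…,x_{n-1}]` (with `k = n - 1`);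
polynomials in `ℤ[x_1,…,x_n]` are regarded as elements of `Polynomial (Rk k)`,
univariate in `x_n`. -/
abbrev Rk (k : ℕ) : Type := MvPolynomial (Fin k) ℤ

/-- The degree of `P ∈ ℤ[x_1,…,x_n]` in the variable `x_i`, `i ≤ n-1`. -/
def degX {k : ℕ} (P : Polynomial (Rk k)) (i : Fin k) : ℕ :=
  P.support.sup fun j => (P.coeff j).degreeOf i

/-- The combined degree of the finite set `S ⊆ ℤ[x_1,…,x_n]` (the maximum over all
variables of the degree of the product of the elements of `S`) is at most `d`. -/
def combDegLE {k : ℕ} (S : Finset (Polynomial (Rk k))) (d : ℕ) : Prop :=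
  (S.prod id).natDegree ≤ d ∧ ∀ i : Fin k, degX (S.prod id) i ≤ d

/-- The `(m,d)`-property for finite sets of polynomials in `ℤ[x_1,…,x_n]`:
the set can be partitioned into at most `m` subsets, each of combined degree at most `d`. -/
def HasMD {k : ℕ} (m d : ℕ) (A : Finset (Polynomial (Rk k))) : Prop :=
  ∃ Part : Finset (Finset (Polynomial (Rk k))),
    Part.card ≤ m ∧ (∀ S ∈ Part, ∀ T ∈ Part, S ≠ T → Disjoint S T) ∧
    Part.sup id = A ∧ ∀ S ∈ Part, combDegLE S d

/-- Combined degree at most `d` for finite sets of polynomials in `ℤ[x_1,…,x_{n-1}]`. -/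
def mvCombDegLE {k : ℕ} (S : Finset (Rk k)) (d : ℕ) : Prop :=
  ∀ i : Fin k, (S.prod id).degreeOf i ≤ d

/-- The `(m,d)`-property for finite sets of polynomials in `ℤ[x_1,…,x_{n-1}]`. -/
def mvHasMD {k : ℕ} (m d : ℕ) (A : Finset (Rk k)) : Prop :=
  ∃ Part : Finset (Finset (Rk k)),
    Part.card ≤ m ∧ (∀ S ∈ Part, ∀ T ∈ Part, S ≠ T → Disjoint S T) ∧
    Part.sup id = A ∧ ∀ S ∈ Part, mvCombDegLE S d

/-- The Sylvester matrix of `f` and `g` with respect to `x_n`. -/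
def sylvesterMat {k : ℕ} (f g : Polynomial (Rk k)) :
    Matrix (Fin (g.natDegree + f.natDegree)) (Fin (g.natDegree + f.natDegree)) (Rk k) :=
  Matrix.of fun i j =>
    if (i : ℕ) < g.natDegree then
      (if (i : ℕ) ≤ (j : ℕ) ∧ (j : ℕ) ≤ (i : ℕ) + f.natDegree then
        f.coeff (f.natDegree + (i : ℕ) - (j : ℕ)) else 0)
    else
      (if (i : ℕ) - g.natDegree ≤ (j : ℕ) ∧ (j : ℕ) ≤ (i : ℕ) then
        g.coeff ((i : ℕ) - (j : ℕ)) else 0)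

/-- The resultant `res_{x_n}(f,g)`, the determinant of the Sylvester matrix. -/
def resX {k : ℕ} (f g : Polynomial (Rk k)) : Rk k := (sylvesterMat f g).det

/-- The discriminant of `f` (of degree `δ ≥ 1` in `x_n`): the element `D` satisfying
`ldcf(f) * D = (-1)^(δ(δ-1)/2) * res_{x_n}(f, f')`. -/
def discX {k : ℕ} (f : Polynomial (Rk k)) : Rk k :=
  if h : ∃ D : Rk k, f.leadingCoeff * D =
      (-1 : Rk k) ^ (f.natDegree * (f.natDegree - 1) / 2) * resX f (derivative f)
  then h.choose else 0

/-- A choice of content and primitive part of `f` over `Rk k`. -/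
def contPair {k : ℕ} (f : Polynomial (Rk k)) : Rk k × Polynomial (Rk k) :=
  if h : ∃ p : Rk k × Polynomial (Rk k), f = Polynomial.C p.1 * p.2 ∧ p.2.IsPrimitive
  then h.choose else (0, 0)

/-- The content of `f` over `Rk k` (determined up to sign). -/
def contX {k : ℕ} (f : Polynomial (Rk k)) : Rk k := (contPair f).1

/-- The primitive part of `f` over `Rk k` (determined up to sign). -/
def primX {k : ℕ} (f : Polynomial (Rk k)) : Polynomial (Rk k) := (contPair f).2

/-- An irreducible basis: a finite set of irreducible polynomials of positive degree
in `x_n` that are pairwise relatively prime. -/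
def IsIrredBasis {k : ℕ} (B : Finset (Polynomial (Rk k))) : Prop :=
  (∀ b ∈ B, 0 < b.natDegree ∧ Irreducible b) ∧
  ∀ b ∈ B, ∀ b' ∈ B, b ≠ b' → IsRelPrime b b'

/-- `B` is an irreducible basis for the primitive parts of `A`: an irreducible basis,
each element of which divides some element of `A`, such that the primitive part of each
element of `A` of positive degree in `x_n` is, up to sign, a product of powers of
elements of `B`. -/
def IsBasisForPrim {k : ℕ} (B A : Finset (Polynomial (Rk k))) : Prop :=
  IsIrredBasis B ∧ (∀ b ∈ B, ∃ a ∈ A, b ∣ a) ∧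
  ∀ a ∈ A, 0 < a.natDegree →
    ∃ e : Polynomial (Rk k) → ℕ,
      primX a = ∏ b ∈ B, b ^ e b ∨ primX a = -∏ b ∈ B, b ^ e b

/-- The (nonzero) `x_n`-coefficients of `f`, as a finite set. -/
def coeffFinset {k : ℕ} (f : Polynomial (Rk k)) : Finset (Rk k) := f.support.image f.coeff

/-- `coeff(B)`: all `x_n`-coefficients of elements of `B`. -/
def coeffsB {k : ℕ} (B : Finset (Polynomial (Rk k))) : Finset (Rk k) := B.biUnion coeffFinset

/-- `disc(B)`. -/
def discB {k : ℕ} (B : Finset (Polynomial (Rk k))) : Finset (Rk k) := B.image discX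

/-- `res(B) = {res(f,g) : f ≠ g ∈ B}`. -/
def resB {k : ℕ} (B : Finset (Polynomial (Rk k))) : Finset (Rk k) :=
  ((B ×ˢ B).filter fun p => p.1 ≠ p.2).image fun p => resX p.1 p.2

/-- `cont(A)`. -/
def contA {k : ℕ} (A : Finset (Polynomial (Rk k))) : Finset (Rk k) := A.image contX

/-- `P(B) = coeff(B) ∪ disc(B) ∪ res(B)`. -/
def projP {k : ℕ} (B : Finset (Polynomial (Rk k))) : Finset (Rk k) :=
  coeffsB B ∪ discB B ∪ resB B

/-- `{res(f,g) : f ∈ F, g ∈ G}`. -/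
def crossRes {k : ℕ} (F G : Finset (Polynomial (Rk k))) : Finset (Rk k) :=
  (F ×ˢ G).image fun p => resX p.1 p.2

/-- The cross resultant set `RES×(𝓕)`. -/
def RESx {k t : ℕ} (F : Fin t → Finset (Polynomial (Rk k))) : Finset (Rk k) :=
  ((Finset.univ : Finset (Fin t × Fin t)).filter fun p => p.1 < p.2).biUnion fun p =>
    ((F p.1 ×ˢ F p.2).filter fun q => q.1 ≠ q.2).image fun q => resX q.1 q.2

/-- The TTICAD projection `P_𝓔(𝓐) = ⋃ᵢ cont(Aᵢ) ∪ ⋃ᵢ P_{Fᵢ}(Bᵢ) ∪ RES×(𝓕)`. -/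
def ttiProj {k t : ℕ} (A B F : Fin t → Finset (Polynomial (Rk k))) : Finset (Rk k) :=
  (Finset.univ.biUnion fun i => contA (A i)) ∪
    (Finset.univ.biUnion fun i => projP (F i) ∪ crossRes (F i) (B i \ F i)) ∪
    RESx F


/-! ### Degrees in the lower variables -/

theorem degX_finSuccEquiv {k : ℕ} (p : MvPolynomial (Fin (k + 1)) ℤ) (i : Fin k) :
    degX (MvPolynomial.finSuccEquiv ℤ k p) i = p.degreeOf i.succ := by
  apply le_antisymm
  · exact Finset.sup_le fun j _ => MvPolynomial.degreeOf_coeff_finSuccEquiv p i j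
  · rw [MvPolynomial.degreeOf_le_iff]
    intro s hs
    have hmem : s.tail ∈ ((MvPolynomial.finSuccEquiv ℤ k p).coeff (s 0)).support := by
      rwa [MvPolynomial.mem_support_coeff_finSuccEquiv, Finsupp.cons_tail]
    have hsup : s 0 ∈ (MvPolynomial.finSuccEquiv ℤ k p).support := by
      rw [Polynomial.mem_support_iff]
      intro h
      simp [h] at hmem
    calc s i.succ = s.tail i := rfl
      _ ≤ ((MvPolynomial.finSuccEquiv ℤ k p).coeff (s 0)).degreeOf i :=
        MvPolynomial.monomial_le_degreeOf i hmem
      _ ≤ _ := Finset.le_sup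
        (f := fun j => ((MvPolynomial.finSuccEquiv ℤ k p).coeff j).degreeOf i) hsup

theorem degX_mul {k : ℕ} {p q : Polynomial (Rk k)} (hp : p ≠ 0) (hq : q ≠ 0) (i : Fin k) :
    degX (p * q) i = degX p i + degX q i := by
  obtain ⟨p, rfl⟩ := (MvPolynomial.finSuccEquiv ℤ k).surjective p
  obtain ⟨q, rfl⟩ := (MvPolynomial.finSuccEquiv ℤ k).surjective q
  rw [← map_mul, degX_finSuccEquiv, degX_finSuccEquiv, degX_finSuccEquiv,
    MvPolynomial.degreeOf_mul_eq]
  · rintro rfl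
    simp at hp
  · rintro rfl
    simp at hq

theorem degX_C {k : ℕ} (c : Rk k) (i : Fin k) : degX (Polynomial.C c) i = c.degreeOf i := by
  by_cases hc : c = 0
  · simp [hc, degX]
  · simp [degX, Polynomial.support_C hc]

theorem degX_prod {k : ℕ} (S : Finset (Polynomial (Rk k))) (hS : ∀ b ∈ S, b ≠ 0) (i : Fin k) :
    degX (∏ b ∈ S, b) i = ∑ b ∈ S, degX b i := by
  induction S using Finset.induction_on with
  | empty => simpa using degX_C (1 : Rk k) i
  | insert a S ha ih =>
    have hS' : ∀ b ∈ S, b ≠ 0 := fun b hb => hS b (Finset.mem_insert_of_mem hb)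
    rw [Finset.prod_insert ha, Finset.sum_insert ha,
      degX_mul (hS a (Finset.mem_insert_self a S)) (Finset.prod_ne_zero_iff.mpr hS'), ih hS']

theorem degX_le_of_dvd {k : ℕ} {p q : Polynomial (Rk k)} (h : p ∣ q) (hq : q ≠ 0) (i : Fin k) :
    degX p i ≤ degX q i := by
  obtain ⟨r, rfl⟩ := h
  rw [degX_mul (left_ne_zero_of_mul hq) (right_ne_zero_of_mul hq)]
  exact Nat.le_add_right _ _

theorem degreeOf_coeff_le_degX {k : ℕ} (p : Polynomial (Rk k)) (j : ℕ) (i : Fin k) :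
    (p.coeff j).degreeOf i ≤ degX p i := by
  by_cases hj : j ∈ p.support
  · exact Finset.le_sup (f := fun j => (p.coeff j).degreeOf i) hj
  · simp [Polynomial.notMem_support_iff.mp hj]

theorem degX_derivative_le {k : ℕ} (p : Polynomial (Rk k)) (i : Fin k) :
    degX (derivative p) i ≤ degX p i := by
  refine Finset.sup_le fun j _ => ?_
  have hcast : ((j : Rk k) + 1) = MvPolynomial.C ((j : ℤ) + 1) := by simp
  rw [Polynomial.coeff_derivative, hcast]
  exact (MvPolynomial.degreeOf_mul_C_le _ _ _).trans (degreeOf_coeff_le_degX _ _ _)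

/-! ### Degrees of resultants and discriminants -/

theorem degreeOf_det_le {k n : ℕ} (M : Matrix (Fin n) (Fin n) (Rk k)) (i : Fin k)
    (r : Fin n → ℕ) (hM : ∀ a b, (M a b).degreeOf i ≤ r a) :
    M.det.degreeOf i ≤ ∑ a, r a := by
  rw [← Matrix.det_transpose, Matrix.det_apply]
  refine (MvPolynomial.degreeOf_sum_le _ _ _).trans (Finset.sup_le fun σ _ => ?_)
  have hprod : (∏ a, M.transpose (σ a) a).degreeOf i ≤ ∑ a, r a :=
    (MvPolynomial.degreeOf_prod_le _ _ _).trans (Finset.sum_le_sum fun a _ => hM a (σ a))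
  rcases Int.units_eq_one_or (Equiv.Perm.sign σ) with h | h
  · simpa [h] using hprod
  · simpa [h, MvPolynomial.degreeOf_neg] using hprod

theorem degreeOf_resX_le {k : ℕ} (f g : Polynomial (Rk k)) (i : Fin k) :
    (resX f g).degreeOf i ≤ g.natDegree * degX f i + f.natDegree * degX g i := by
  refine (degreeOf_det_le (sylvesterMat f g) i
    (fun a => if (a : ℕ) < g.natDegree then degX f i else degX g i) fun a b => ?_).trans ?_
  · simp only [sylvesterMat, Matrix.of_apply]
    split_ifs <;> first | exact degreeOf_coeff_le_degX _ _ _ | simp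
  · simp [Fin.sum_univ_add]

theorem degreeOf_discX_le {k : ℕ} {f : Polynomial (Rk k)} (hf : f ≠ 0) (i : Fin k) :
    (discX f).degreeOf i ≤ f.natDegree * degX f i + f.natDegree * degX f i := by
  unfold discX
  split_ifs with h
  · have hD := h.choose_spec
    set D := h.choose
    by_cases hD0 : D = 0
    · simp [hD0]
    have hres : (resX f (derivative f)).degreeOf i
        ≤ f.natDegree * degX f i + f.natDegree * degX f i := by
      refine (degreeOf_resX_le _ _ i).trans (add_le_add ?_ ?_)
      · exact Nat.mul_le_mul_right _ ((natDegree_derivative_le f).trans (Nat.sub_le _ _))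
      · exact Nat.mul_le_mul_left _ (degX_derivative_le f i)
    have hdeg := congrArg (MvPolynomial.degreeOf i) hD
    rw [MvPolynomial.degreeOf_mul_eq (leadingCoeff_ne_zero.mpr hf) hD0] at hdeg
    have hsign : ((-1 : Rk k) ^ (f.natDegree * (f.natDegree - 1) / 2)
        * resX f (derivative f)).degreeOf i = (resX f (derivative f)).degreeOf i := by
      rcases neg_one_pow_eq_or (Rk k) (f.natDegree * (f.natDegree - 1) / 2) with h | h <;>
        simp [h, MvPolynomial.degreeOf_neg]
    omega
  · simp

/-! ### Total degrees of finite sets -/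

/-- The sum of the degrees in `x_i` of the elements of `S`. -/
def sumDeg {k : ℕ} (i : Fin k) (S : Finset (Rk k)) : ℕ := ∑ s ∈ S, s.degreeOf i

theorem sumDeg_mono {k : ℕ} (i : Fin k) {S T : Finset (Rk k)} (h : S ⊆ T) :
    sumDeg i S ≤ sumDeg i T :=
  Finset.sum_le_sum_of_subset h

theorem sumDeg_union_le {k : ℕ} (i : Fin k) (S T : Finset (Rk k)) :
    sumDeg i (S ∪ T) ≤ sumDeg i S + sumDeg i T := by
  have := Finset.sum_union_inter (s₁ := S) (s₂ := T) (f := fun s : Rk k => s.degreeOf i)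
  unfold sumDeg
  omega

theorem sumDeg_singleton {k : ℕ} (i : Fin k) (c : Rk k) : sumDeg i {c} = c.degreeOf i :=
  Finset.sum_singleton _ _

theorem sumDeg_biUnion_le {k : ℕ} {ι : Type*} (i : Fin k) (S : Finset ι)
    (g : ι → Finset (Rk k)) :
    sumDeg i (S.biUnion g) ≤ ∑ x ∈ S, sumDeg i (g x) := by
  induction S using Finset.induction_on with
  | empty => simp [sumDeg]
  | insert a S ha ih =>
    rw [Finset.biUnion_insert, Finset.sum_insert ha]
    exact (sumDeg_union_le _ _ _).trans (Nat.add_le_add_left ih _)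

theorem sumDeg_image_le {k : ℕ} {ι : Type*} (i : Fin k) (S : Finset ι) (g : ι → Rk k) :
    sumDeg i (S.image g) ≤ ∑ x ∈ S, (g x).degreeOf i := by
  rw [← Finset.biUnion_singleton]
  simpa only [sumDeg_singleton] using sumDeg_biUnion_le i S fun x => {g x}

theorem sumDeg_crossRes_le {k : ℕ} (i : Fin k) (F G : Finset (Polynomial (Rk k))) :
    sumDeg i (crossRes F G) ≤
      (∑ g ∈ G, g.natDegree) * (∑ f ∈ F, degX f i) +
        (∑ f ∈ F, f.natDegree) * ∑ g ∈ G, degX g i := by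
  calc sumDeg i (crossRes F G) ≤ ∑ p ∈ F ×ˢ G, (resX p.1 p.2).degreeOf i := sumDeg_image_le i _ _
    _ ≤ ∑ p ∈ F ×ˢ G, (p.2.natDegree * degX p.1 i + p.1.natDegree * degX p.2 i) :=
      Finset.sum_le_sum fun p _ => degreeOf_resX_le _ _ i
    _ = _ := by
      rw [Finset.sum_add_distrib, Finset.sum_product_right, Finset.sum_product,
        Finset.sum_mul_sum, Finset.sum_mul_sum]

theorem sumDeg_disc_res_le {k : ℕ} (i : Fin k) {F : Finset (Polynomial (Rk k))}
    (hF : ∀ f ∈ F, f ≠ 0) :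
    sumDeg i (discB F ∪ resB F) ≤ 2 * ((∑ f ∈ F, f.natDegree) * ∑ f ∈ F, degX f i) := by
  set w : Polynomial (Rk k) × Polynomial (Rk k) → ℕ :=
    fun p => p.2.natDegree * degX p.1 i + p.1.natDegree * degX p.2 i with hw
  have hdisc : sumDeg i (discB F) ≤ ∑ p ∈ F.diag, w p := by
    rw [Finset.sum_diag]
    exact (sumDeg_image_le i _ _).trans (Finset.sum_le_sum fun f hf => degreeOf_discX_le (hF f hf) i)
  have hres : sumDeg i (resB F) ≤ ∑ p ∈ F.offDiag, w p := by
    have hoff : ((F ×ˢ F).filter fun p => p.1 ≠ p.2) = F.offDiag := by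
      ext p
      simp [Finset.mem_offDiag, and_assoc]
    rw [resB, hoff]
    exact (sumDeg_image_le i _ _).trans (Finset.sum_le_sum fun p _ => degreeOf_resX_le _ _ i)
  calc sumDeg i (discB F ∪ resB F) ≤ ∑ p ∈ F.diag, w p + ∑ p ∈ F.offDiag, w p :=
        (sumDeg_union_le _ _ _).trans (add_le_add hdisc hres)
    _ = ∑ p ∈ F ×ˢ F, w p := by
      rw [← Finset.sum_union (Finset.disjoint_diag_offDiag F), Finset.diag_union_offDiag]
    _ = _ := by
      rw [hw, Finset.sum_add_distrib, Finset.sum_product_right, Finset.sum_product,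
        Finset.sum_mul_sum]
      ring

theorem sumDeg_coeffsB_le {k d : ℕ} (i : Fin k) (F : Finset (Polynomial (Rk k)))
    (hF : ∀ f ∈ F, f.natDegree ≤ d) :
    sumDeg i (coeffsB F) ≤ (d + 1) * ∑ f ∈ F, degX f i := by
  rw [Finset.mul_sum]
  refine (sumDeg_biUnion_le _ _ _).trans (Finset.sum_le_sum fun f hf => ?_)
  calc sumDeg i (coeffFinset f) ≤ ∑ j ∈ f.support, (f.coeff j).degreeOf i := sumDeg_image_le i _ _
    _ ≤ f.support.card * degX f i := by
      rw [← smul_eq_mul]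
      exact Finset.sum_le_card_nsmul _ _ _ fun j _ => degreeOf_coeff_le_degX _ _ _
    _ ≤ (d + 1) * degX f i :=
      Nat.mul_le_mul_right _ ((card_supp_le_succ_natDegree f).trans
        (Nat.succ_le_succ (hF f hf)))

/-! ### Building partitions -/

theorem mvHasMD_union {k M d : ℕ} {A S : Finset (Rk k)} (hA : mvHasMD M d A)
    (hS : ∀ i, sumDeg i S ≤ d) : mvHasMD (M + 1) d (A ∪ S) := by
  obtain ⟨Part, hcard, hdisj, hsup, hdeg⟩ := hA
  have hsub : ∀ T ∈ Part, Disjoint T (S \ A) := fun T hT =>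
    Finset.disjoint_sdiff.mono_left (hsup ▸ Finset.le_sup (f := id) hT)
  refine ⟨insert (S \ A) Part, (Finset.card_insert_le _ _).trans (Nat.succ_le_succ hcard),
    ?_, ?_, ?_⟩
  · intro T hT U hU hne
    rw [Finset.mem_insert] at hT hU
    rcases hT with rfl | hT <;> rcases hU with rfl | hU
    · exact absurd rfl hne
    · exact (hsub U hU).symm
    · exact hsub T hT
    · exact hdisj T hT U hU hne
  · rw [Finset.sup_insert, hsup, id, sup_comm]
    exact Finset.union_sdiff_self_eq_union
  · intro T hT i
    rw [Finset.mem_insert] at hT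
    rcases hT with rfl | hT
    · exact (MvPolynomial.degreeOf_prod_le _ _ _).trans
        ((sumDeg_mono i Finset.sdiff_subset).trans (hS i))
    · exact hdeg T hT i

theorem mvHasMD_biUnion {k d : ℕ} {ι : Type*} (t : Finset ι) (S : ι → Finset (Rk k))
    (hS : ∀ a ∈ t, ∀ i, sumDeg i (S a) ≤ d) : mvHasMD t.card d (t.biUnion S) := by
  induction t using Finset.induction_on with
  | empty => exact ⟨∅, by simp, by simp, by simp, by simp⟩
  | insert a t ha ih =>
    rw [Finset.card_insert_of_notMem ha, Finset.biUnion_insert, Finset.union_comm]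
    exact mvHasMD_union (ih fun b hb => hS b (Finset.mem_insert_of_mem hb))
      (hS a (Finset.mem_insert_self a t))

theorem mvHasMD.mono {k M N d : ℕ} {A : Finset (Rk k)} (h : mvHasMD M d A) (hMN : M ≤ N) :
    mvHasMD N d A := by
  obtain ⟨Part, hcard, hPart⟩ := h
  exact ⟨Part, hcard.trans hMN, hPart⟩

/-! ### Contents and irreducible bases -/

theorem eq_C_contX_mul_primX {k : ℕ} (f : Polynomial (Rk k)) :
    f = Polynomial.C (contX f) * primX f := by
  have h : ∃ p : Rk k × Polynomial (Rk k), f = Polynomial.C p.1 * p.2 ∧ p.2.IsPrimitive := by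
    let _ : StrongNormalizationMonoid (Rk k) :=
      UniqueFactorizationMonoid.strongNormalizationMonoid
    let _ : NormalizedGCDMonoid (Rk k) := UniqueFactorizationMonoid.toNormalizedGCDMonoid (Rk k)
    exact ⟨(f.content, f.primPart), f.eq_C_content_mul_primPart, f.isPrimitive_primPart⟩
  have hpair : contPair f = h.choose := dif_pos h
  rw [contX, primX, hpair]
  exact h.choose_spec.1

theorem dvd_primX_of_dvd {k : ℕ} {a b : Polynomial (Rk k)} (ha : a ≠ 0) (hb : Irreducible b)
    (hdeg : 0 < b.natDegree) (h : b ∣ a) : b ∣ primX a := by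
  rw [eq_C_contX_mul_primX a] at h ha
  refine (hb.prime.dvd_or_dvd h).resolve_left fun hC => ?_
  have := natDegree_le_of_dvd hC (left_ne_zero_of_mul ha)
  rw [natDegree_C] at this
  omega

theorem C_contX_mul_prod_dvd {k : ℕ} {a : Polynomial (Rk k)} (ha : a ≠ 0)
    {G : Finset (Polynomial (Rk k))} (hG : IsIrredBasis G) (hdvd : ∀ b ∈ G, b ∣ a) :
    Polynomial.C (contX a) * ∏ b ∈ G, b ∣ a := by
  conv_rhs => rw [eq_C_contX_mul_primX a]
  refine mul_dvd_mul_left _ (Finset.prod_dvd_of_isRelPrime ?_ fun b hb => ?_)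
  · exact fun b hb b' hb' hne => hG.2 b hb b' hb' hne
  · exact dvd_primX_of_dvd ha (hG.1 b hb).2 (hG.1 b hb).1 (hdvd b hb)

theorem sum_natDegree_le_of_dvd {k : ℕ} {a : Polynomial (Rk k)} (ha : a ≠ 0)
    {G : Finset (Polynomial (Rk k))} (hG : IsIrredBasis G) (hdvd : ∀ b ∈ G, b ∣ a) :
    ∑ b ∈ G, b.natDegree ≤ a.natDegree := by
  rw [← natDegree_prod G (fun b => b) fun b hb => (hG.1 b hb).2.ne_zero]
  exact natDegree_le_of_dvd ((dvd_mul_left _ _).trans (C_contX_mul_prod_dvd ha hG hdvd)) ha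

theorem degreeOf_contX_add_sum_degX_le {k : ℕ} {a : Polynomial (Rk k)} (ha : a ≠ 0)
    {G : Finset (Polynomial (Rk k))} (hG : IsIrredBasis G) (hdvd : ∀ b ∈ G, b ∣ a) (i : Fin k) :
    (contX a).degreeOf i + ∑ b ∈ G, degX b i ≤ degX a i := by
  have hG0 : ∀ b ∈ G, b ≠ 0 := fun b hb => (hG.1 b hb).2.ne_zero
  have h := C_contX_mul_prod_dvd ha hG hdvd
  have h0 := ne_zero_of_dvd_ne_zero ha h
  rw [← degX_prod G hG0, ← degX_C, ← degX_mul (left_ne_zero_of_mul h0) (right_ne_zero_of_mul h0)]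
  exact degX_le_of_dvd h ha i

theorem IsIrredBasis.subset {k : ℕ} {G H : Finset (Polynomial (Rk k))} (hH : IsIrredBasis H)
    (h : G ⊆ H) : IsIrredBasis G :=
  ⟨fun b hb => hH.1 b (h hb), fun b hb b' hb' => hH.2 b (h hb) b' (h hb')⟩

theorem mem_of_dvd_of_isBasisForPrim {k : ℕ} {B F : Finset (Polynomial (Rk k))}
    {f b : Polynomial (Rk k)} (hB : IsIrredBasis B) (hFB : F ⊆ B) (hF : IsBasisForPrim F {f})
    (hf : 0 < f.natDegree) (hb : b ∈ B) (h : b ∣ f) : b ∈ F := by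
  have hf0 : f ≠ 0 := fun h0 => by simp [h0] at hf
  obtain ⟨hbdeg, hbirr⟩ := hB.1 b hb
  have hbprim := dvd_primX_of_dvd hf0 hbirr hbdeg h
  obtain ⟨e, he⟩ := hF.2.2 f (Finset.mem_singleton_self f) hf
  have hprod : b ∣ ∏ c ∈ F, c ^ e c := by
    rcases he with he | he
    · rwa [he] at hbprim
    · rw [he] at hbprim
      exact (dvd_neg (α := Polynomial (Rk k))).mp hbprim
  obtain ⟨c, hc, hbc⟩ := hbirr.prime.exists_mem_finset_dvd hprod
  by_contra hbF
  have hne : b ≠ c := fun h => hbF (h ▸ hc)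
  exact hbirr.not_isUnit (hB.2 b hb c (hFB hc) hne dvd_rfl (hbirr.prime.dvd_of_dvd_pow hbc))

/-- Let `A` be a set of `m` nonzero polynomials in `ℤ[x_1,…,x_n]` (n ≥ 2),
each of degree at most `d ≥ 1` in every variable, and let `E = {f} ⊆ A` with `f` of
positive degree in `x_n`.  Then for any irreducible basis `B` for the primitive parts of
`A` and any irreducible basis `F ⊆ B` for the primitive parts of `E`, the reduced
projection `P_E(A) = cont(A) ∪ P(F) ∪ {res(f,g) : f ∈ F, g ∈ B ∖ F}` has the
`(⌊(3m+1)/2⌋, 2d²)`-property. -/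
theorem reduced_projection_md_property
    (k : ℕ) (hk : 1 ≤ k) (m d : ℕ) (hd : 1 ≤ d)
    (A : Finset (Polynomial (Rk k))) (hAcard : A.card = m)
    (hA : ∀ a ∈ A, a ≠ 0 ∧ a.natDegree ≤ d ∧ ∀ i : Fin k, degX a i ≤ d)
    (f : Polynomial (Rk k)) (hfA : f ∈ A) (hfdeg : 0 < f.natDegree)
    (B : Finset (Polynomial (Rk k))) (hB : IsBasisForPrim B A)
    (F : Finset (Polynomial (Rk k))) (hFB : F ⊆ B)
    (hF : IsBasisForPrim F ({f} : Finset (Polynomial (Rk k)))) :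
    mvHasMD ((3 * m + 1) / 2) (2 * d ^ 2) (contA A ∪ projP F ∪ crossRes F (B \ F)) := by
  have hdvdF : ∀ b ∈ F, b ∣ f := fun b hb => by
    obtain ⟨a, ha, hba⟩ := hF.2.1 b hb
    rwa [Finset.mem_singleton.mp ha] at hba
  have hFdeg : ∑ b ∈ F, b.natDegree ≤ d :=
    (sum_natDegree_le_of_dvd (hA f hfA).1 hF.1 hdvdF).trans (hA f hfA).2.1
  have hFX : ∀ i, (contX f).degreeOf i + ∑ b ∈ F, degX b i ≤ d := fun i =>
    (degreeOf_contX_add_sum_degX_le (hA f hfA).1 hF.1 hdvdF i).trans ((hA f hfA).2.2 i)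
  choose! α hαA hαdvd using hB.2.1
  set G : Polynomial (Rk k) → Finset (Polynomial (Rk k)) :=
    fun a => (B \ F).filter fun b => α b = a with hG
  have hGB : ∀ a, G a ⊆ B := fun a => (Finset.filter_subset _ _).trans Finset.sdiff_subset
  have hGdvd : ∀ a, ∀ b ∈ G a, b ∣ a := fun a b hb =>
    (Finset.mem_filter.mp hb).2 ▸ hαdvd b (hGB a hb)
  have hothers : mvHasMD (A.erase f).card (2 * d ^ 2)
      ((A.erase f).biUnion fun a => {contX a} ∪ crossRes F (G a)) := by
    refine mvHasMD_biUnion _ _ fun a ha i => ?_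
    obtain ⟨ha0, had, haX⟩ := hA a (Finset.mem_of_mem_erase ha)
    have hGirr := hB.1.subset (hGB a)
    have hdeg := (sum_natDegree_le_of_dvd ha0 hGirr (hGdvd a)).trans had
    have hX := (degreeOf_contX_add_sum_degX_le ha0 hGirr (hGdvd a) i).trans (haX i)
    have hFXi : ∑ b ∈ F, degX b i ≤ d := (Nat.le_add_left _ _).trans (hFX i)
    calc sumDeg i ({contX a} ∪ crossRes F (G a))
        ≤ (contX a).degreeOf i + (d * d + d * ∑ b ∈ G a, degX b i) := by
          refine (sumDeg_union_le _ _ _).trans ?_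
          rw [sumDeg_singleton]
          exact Nat.add_le_add_left ((sumDeg_crossRes_le i F (G a)).trans
            (add_le_add (Nat.mul_le_mul hdeg hFXi) (Nat.mul_le_mul_right _ hFdeg))) _
      _ ≤ d * d + d * ((contX a).degreeOf i + ∑ b ∈ G a, degX b i) := by
          nlinarith [Nat.zero_le ((contX a).degreeOf i)]
      _ ≤ 2 * d ^ 2 := by nlinarith
  have hcoeff : ∀ i, sumDeg i ({contX f} ∪ coeffsB F) ≤ 2 * d ^ 2 := fun i => by
    have hle : ∀ b ∈ F, b.natDegree ≤ d := fun b hb =>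
      (Finset.single_le_sum (f := fun b : Polynomial (Rk k) => b.natDegree)
        (fun _ _ => Nat.zero_le _) hb).trans hFdeg
    have hu := sumDeg_union_le i {contX f} (coeffsB F)
    rw [sumDeg_singleton] at hu
    have hc := sumDeg_coeffsB_le i F hle
    nlinarith [hFX i, Nat.zero_le ((contX f).degreeOf i)]
  have hdisc : ∀ i, sumDeg i (discB F ∪ resB F) ≤ 2 * d ^ 2 := fun i => by
    have hFXi : ∑ b ∈ F, degX b i ≤ d := (Nat.le_add_left _ _).trans (hFX i)
    have := Nat.mul_le_mul hFdeg hFXi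
    have := sumDeg_disc_res_le i fun b hb => (hF.1.1 b hb).2.ne_zero
    nlinarith
  have hcross : crossRes F (B \ F) = (A.erase f).biUnion fun a => crossRes F (G a) := by
    ext r
    simp only [crossRes, Finset.mem_image, Finset.mem_product, Finset.mem_biUnion, hG,
      Finset.mem_filter, Finset.mem_erase]
    constructor
    · rintro ⟨p, ⟨hp₁, hp₂⟩, rfl⟩
      obtain ⟨hpB, hpF⟩ := Finset.mem_sdiff.mp hp₂
      refine ⟨α p.2, ⟨fun hαf => hpF ?_, hαA _ hpB⟩, p, ⟨hp₁, hp₂, rfl⟩, rfl⟩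
      exact mem_of_dvd_of_isBasisForPrim hB.1 hFB hF hfdeg hpB (hαf ▸ hαdvd _ hpB)
    · rintro ⟨a, -, p, ⟨hp₁, hp₂, -⟩, rfl⟩
      exact ⟨p, ⟨hp₁, hp₂⟩, rfl⟩
  have hcont : contA A = {contX f} ∪ (A.erase f).biUnion fun a => {contX a} := by
    rw [contA, ← Finset.insert_erase hfA, Finset.image_insert, Finset.erase_insert_eq_erase,
      Finset.erase_idem, Finset.biUnion_singleton, Finset.insert_eq]
  have hset : contA A ∪ projP F ∪ crossRes F (B \ F) =
      (((A.erase f).biUnion fun a => {contX a} ∪ crossRes F (G a)) ∪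
        ({contX f} ∪ coeffsB F)) ∪ (discB F ∪ resB F) := by
    rw [hcross, hcont, projP]
    ext r
    simp only [Finset.mem_union, Finset.mem_biUnion, and_or_left, exists_or]
    generalize (∃ a ∈ A.erase f, r ∈ ({contX a} : Finset (Rk k))) = p
    generalize (∃ a ∈ A.erase f, r ∈ crossRes F (G a)) = q
    tauto
  rw [hset]
  refine (mvHasMD_union (mvHasMD_union hothers hcoeff) hdisc).mono ?_
  rw [Finset.card_erase_of_mem hfA, hAcard]
  have : 0 < m := hAcard ▸ Finset.card_pos.mpr ⟨f, hfA⟩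
  omega

end
end

section
/- Let 𝓐 = (A_1,…,A_t) be a list of irreducible bases in ℤ[x_1,…,x_n] and 𝓔 = (E_1,…,E_t) with nonempty E_i ⊆ A_i, such that any two distinct elements of A = ⋃_i A_i are relatively prime. Define the ResCAD set 𝓡 = E ∪ ⋃_{i=1}^t {res_{x_n}(f,g) : f ∈ E_i, g ∈ A_i ∖ E_i}, where E = ⋃_i E_i. Then, after discarding integer constants and identifying resultants that differ only by sign, the McCallum projection P(𝓡), computed with E as irreducible basis for the primitive parts of 𝓡, equals the TTICAD projection P_𝓔(𝓐). (Here every element of A, being irreducible of positive degree in x_n, is primitive over ℤ[x_1,…,x_{n−1}], so its content is ±1.) -/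
open Polynomial
open scoped Classical

noncomputable section

/-- The ResCAD set `𝓡 = E ∪ ⋃ᵢ {res(f,g) : f ∈ Eᵢ, g ∈ Aᵢ ∖ Eᵢ}`, where
`E = ⋃ᵢ Eᵢ` and the resultants (elements of `ℤ[x_1,…,x_{n-1}]`) are regarded as
polynomials in `ℤ[x_1,…,x_n]` of degree 0 in `x_n`. -/
def resCADSet {k t : ℕ} (A E : Fin t → Finset (Polynomial (Rk k))) :
    Finset (Polynomial (Rk k)) :=
  Finset.univ.biUnion E ∪
    Finset.univ.biUnion fun i => (crossRes (E i) (A i \ E i)).image Polynomial.C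

/-- The McCallum projection of the ResCAD set, computed with `E = ⋃ᵢ Eᵢ` as the
irreducible basis for the primitive parts: `cont(𝓡) ∪ coeff(E) ∪ disc(E) ∪ res(E)`. -/
def projResCAD {k t : ℕ} (A E : Fin t → Finset (Polynomial (Rk k))) : Finset (Rk k) :=
  contA (resCADSet A E) ∪ projP (Finset.univ.biUnion E)

/-- The TTICAD projection `P_𝓔(𝓐) = ⋃ᵢ P_{Eᵢ}(Aᵢ) ∪ RES×(𝓔)` (here each `Aᵢ` is an
irreducible basis, so it is its own basis and `Eᵢ` the basis of `Eᵢ`). -/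
def projTTI {k t : ℕ} (A E : Fin t → Finset (Polynomial (Rk k))) : Finset (Rk k) :=
  (Finset.univ.biUnion fun i => projP (E i) ∪ crossRes (E i) (A i \ E i)) ∪ RESx E

/-- Exchanging the arguments permutes the rows of the Sylvester matrix. -/
theorem sylvesterMat_swap {k : ℕ} (f g : Polynomial (Rk k)) :
    sylvesterMat g f =
      (sylvesterMat f g).submatrix finAddFlip (finCongr (Nat.add_comm _ _)) := by
  ext1 i j
  refine Fin.addCases (fun a => ?_) (fun a => ?_) i
  · simp only [sylvesterMat, Matrix.of_apply, Matrix.submatrix_apply, finAddFlip_apply_castAdd,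
      finCongr_apply, Fin.val_castAdd, Fin.val_natAdd, Fin.val_cast]
    simp [Nat.add_comm g.natDegree a]
  · simp only [sylvesterMat, Matrix.of_apply, Matrix.submatrix_apply, finAddFlip_apply_natAdd,
      finCongr_apply, Fin.val_castAdd, Fin.val_natAdd, Fin.val_cast]
    simp [Nat.add_comm f.natDegree a]

/-- The resultant is symmetric up to sign. -/
theorem resX_swap {k : ℕ} (f g : Polynomial (Rk k)) :
    resX g f = resX f g ∨ resX g f = -resX f g := by
  set e : Fin (f.natDegree + g.natDegree) ≃ Fin (g.natDegree + f.natDegree) :=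
    finCongr (Nat.add_comm _ _)
  have h : sylvesterMat g f =
      ((sylvesterMat f g).submatrix e e).submatrix (finAddFlip.trans e.symm) id := by
    rw [sylvesterMat_swap, Matrix.submatrix_submatrix]
    congr 1
  have hdet : resX g f =
      ((Equiv.Perm.sign (finAddFlip.trans e.symm) : ℤ) : Rk k) * resX f g := by
    rw [resX, h, Matrix.det_permute, Matrix.det_submatrix_equiv_self, resX]
  rcases Int.units_eq_one_or (Equiv.Perm.sign (finAddFlip.trans e.symm)) with hs | hs
  · left
    simpa [hs] using hdet
  · right
    simpa [hs] using hdet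

/-- The units of `ℤ[x_1,…,x_{n-1}]` are `1` and `-1`. -/
theorem Rk.eq_one_or_neg_one_of_isUnit {k : ℕ} {u : Rk k} (hu : IsUnit u) :
    u = 1 ∨ u = -1 := by
  obtain ⟨c, hc, rfl⟩ := MvPolynomial.isUnit_iff_eq_C_of_isReduced.mp hu
  rcases Int.isUnit_iff.mp hc with rfl | rfl <;> simp

theorem contPair_spec {k : ℕ} {f : Polynomial (Rk k)}
    (h : ∃ p : Rk k × Polynomial (Rk k), f = Polynomial.C p.1 * p.2 ∧ p.2.IsPrimitive) :
    f = Polynomial.C (contX f) * primX f ∧ (primX f).IsPrimitive := by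
  have hp : contPair f = h.choose := dif_pos h
  rw [contX, primX, hp]
  exact h.choose_spec

theorem contX_of_isPrimitive {k : ℕ} {f : Polynomial (Rk k)} (hf : f.IsPrimitive) :
    contX f = 1 ∨ contX f = -1 :=
  have hspec := contPair_spec ⟨(1, f), by simp, hf⟩
  Rk.eq_one_or_neg_one_of_isUnit (hf _ ⟨primX f, hspec.1⟩)

theorem contX_C {k : ℕ} (r : Rk k) :
    contX (Polynomial.C r) = r ∨ contX (Polynomial.C r) = -r := by
  obtain ⟨heq, hprim⟩ := contPair_spec (f := Polynomial.C r)
    ⟨(r, 1), by simp, Polynomial.isPrimitive_one⟩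
  set c := contX (Polynomial.C r)
  set q := primX (Polynomial.C r)
  by_cases hc : c = 0
  · left
    rw [hc, Polynomial.C_0, zero_mul, Polynomial.C_eq_zero] at heq
    rw [hc, heq]
  have hdeg : q.natDegree = 0 := by
    rw [← Polynomial.natDegree_C_mul hc, ← heq, Polynomial.natDegree_C]
  obtain ⟨u, hu⟩ := Polynomial.natDegree_eq_zero.mp hdeg
  have hur : r = c * u := by
    rw [← hu, ← Polynomial.C_mul] at heq
    exact Polynomial.C_injective heq
  rcases Rk.eq_one_or_neg_one_of_isUnit (hprim u ⟨1, by simp [hu]⟩) with rfl | rfl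
  · left
    simp [hur]
  · right
    simp [hur]

theorem mem_crossRes {k : ℕ} {F G : Finset (Polynomial (Rk k))} {x : Rk k} :
    x ∈ crossRes F G ↔ ∃ f ∈ F, ∃ g ∈ G, resX f g = x := by
  simp [crossRes, and_assoc]

theorem mem_projP {k : ℕ} {B : Finset (Polynomial (Rk k))} {x : Rk k} :
    x ∈ projP B ↔ (∃ f ∈ B, x ∈ coeffFinset f) ∨ (∃ f ∈ B, discX f = x) ∨
      ∃ f ∈ B, ∃ g ∈ B, f ≠ g ∧ resX f g = x := by
  simp [projP, coeffsB, discB, resB, and_assoc]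

theorem mem_RESx {k t : ℕ} {F : Fin t → Finset (Polynomial (Rk k))} {x : Rk k} :
    x ∈ RESx F ↔ ∃ i j, i < j ∧ ∃ f ∈ F i, ∃ g ∈ F j, f ≠ g ∧ resX f g = x := by
  simp [RESx, and_assoc]

theorem mem_projTTI {k t : ℕ} {A E : Fin t → Finset (Polynomial (Rk k))} {x : Rk k} :
    x ∈ projTTI A E ↔
      (∃ i, x ∈ projP (E i) ∨ x ∈ crossRes (E i) (A i \ E i)) ∨ x ∈ RESx E := by
  simp [projTTI]

theorem mem_projResCAD {k t : ℕ} {A E : Fin t → Finset (Polynomial (Rk k))} {x : Rk k} :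
    x ∈ projResCAD A E ↔
      (∃ i, ∃ f ∈ E i, contX f = x) ∨
      (∃ i, ∃ r ∈ crossRes (E i) (A i \ E i), contX (Polynomial.C r) = x) ∨
      x ∈ projP (Finset.univ.biUnion E) := by
  simp only [projResCAD, contA, resCADSet, Finset.mem_union, Finset.mem_image,
    Finset.mem_biUnion, Finset.mem_univ, true_and, or_and_right, exists_or, or_assoc]
  refine or_congr ⟨?_, ?_⟩ (or_congr_left ⟨?_, ?_⟩)
  · rintro ⟨f, ⟨i, hf⟩, rfl⟩
    exact ⟨i, f, hf, rfl⟩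
  · rintro ⟨i, f, hf, rfl⟩
    exact ⟨f, ⟨i, hf⟩, rfl⟩
  · rintro ⟨_, ⟨i, r, hr, rfl⟩, rfl⟩
    exact ⟨i, r, hr, rfl⟩
  · rintro ⟨i, r, hr, rfl⟩
    exact ⟨_, ⟨i, r, hr, rfl⟩, rfl⟩

/-- Every resultant of distinct elements of `⋃ᵢ Eᵢ` lies, up to sign, in the TTICAD
projection. -/
theorem resX_mem_projTTI_or_neg {k t : ℕ} {A E : Fin t → Finset (Polynomial (Rk k))}
    {i j : Fin t} {f g : Polynomial (Rk k)} (hf : f ∈ E i) (hg : g ∈ E j) (hfg : f ≠ g) :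
    resX f g ∈ projTTI A E ∨ -resX f g ∈ projTTI A E := by
  rcases lt_trichotomy i j with h | rfl | h
  · exact .inl (mem_projTTI.mpr (.inr (mem_RESx.mpr ⟨i, j, h, f, hf, g, hg, hfg, rfl⟩)))
  · exact .inl (mem_projTTI.mpr (.inl ⟨i, .inl (mem_projP.mpr
      (.inr (.inr ⟨f, hf, g, hg, hfg, rfl⟩)))⟩))
  · have hmem : resX g f ∈ projTTI A E :=
      mem_projTTI.mpr (.inr (mem_RESx.mpr ⟨j, i, h, g, hg, f, hf, hfg.symm, rfl⟩))
    rcases resX_swap f g with hs | hs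
    · exact .inl (hs ▸ hmem)
    · exact .inr (hs ▸ hmem)

theorem mem_projTTI_or_neg_of_mem_projResCAD {k t : ℕ}
    {A E : Fin t → Finset (Polynomial (Rk k))} (hprim : ∀ i, ∀ f ∈ E i, f.IsPrimitive)
    {x : Rk k} (hconst : ¬ ∃ c : ℤ, x = MvPolynomial.C c) (hx : x ∈ projResCAD A E) :
    x ∈ projTTI A E ∨ -x ∈ projTTI A E := by
  rcases mem_projResCAD.mp hx with ⟨i, f, hf, rfl⟩ | ⟨i, r, hr, rfl⟩ | hP
  · rcases contX_of_isPrimitive (hprim i f hf) with h | h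
    · exact absurd ⟨1, by simp [h]⟩ hconst
    · exact absurd ⟨-1, by simp [h]⟩ hconst
  · have hmem : r ∈ projTTI A E := mem_projTTI.mpr (.inl ⟨i, .inr hr⟩)
    rcases contX_C r with h | h
    · exact .inl (by rwa [h])
    · exact .inr (by rwa [h, neg_neg])
  · rcases mem_projP.mp hP with ⟨f, hf, h⟩ | ⟨f, hf, h⟩ | ⟨f, hf, g, hg, hfg, rfl⟩
    · obtain ⟨i, -, hi⟩ := Finset.mem_biUnion.mp hf
      exact .inl (mem_projTTI.mpr (.inl ⟨i, .inl (mem_projP.mpr (.inl ⟨f, hi, h⟩))⟩))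
    · obtain ⟨i, -, hi⟩ := Finset.mem_biUnion.mp hf
      exact .inl (mem_projTTI.mpr (.inl ⟨i, .inl (mem_projP.mpr (.inr (.inl ⟨f, hi, h⟩)))⟩))
    · obtain ⟨i, -, hi⟩ := Finset.mem_biUnion.mp hf
      obtain ⟨j, -, hj⟩ := Finset.mem_biUnion.mp hg
      exact resX_mem_projTTI_or_neg hi hj hfg

theorem projP_mono {k : ℕ} {B B' : Finset (Polynomial (Rk k))} (h : B ⊆ B') :
    projP B ⊆ projP B' := by
  intro x hx
  rw [mem_projP] at hx ⊢
  rcases hx with ⟨f, hf, hx⟩ | ⟨f, hf, hx⟩ | ⟨f, hf, g, hg, hx⟩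
  · exact .inl ⟨f, h hf, hx⟩
  · exact .inr (.inl ⟨f, h hf, hx⟩)
  · exact .inr (.inr ⟨f, h hf, g, h hg, hx⟩)

theorem mem_projResCAD_or_neg_of_mem_projTTI {k t : ℕ}
    {A E : Fin t → Finset (Polynomial (Rk k))} {x : Rk k} (hx : x ∈ projTTI A E) :
    x ∈ projResCAD A E ∨ -x ∈ projResCAD A E := by
  have hsub (i : Fin t) : E i ⊆ Finset.univ.biUnion E :=
    Finset.subset_biUnion_of_mem E (Finset.mem_univ i)
  rcases mem_projTTI.mp hx with ⟨i, hP | hr⟩ | hR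
  · exact .inl (mem_projResCAD.mpr (.inr (.inr (projP_mono (hsub i) hP))))
  · have hmem : contX (Polynomial.C x) ∈ projResCAD A E :=
      mem_projResCAD.mpr (.inr (.inl ⟨i, x, hr, rfl⟩))
    rcases contX_C x with h | h
    · exact .inl (h ▸ hmem)
    · exact .inr (h ▸ hmem)
  · obtain ⟨i, j, -, f, hf, g, hg, hfg, rfl⟩ := mem_RESx.mp hR
    exact .inl (mem_projResCAD.mpr (.inr (.inr (mem_projP.mpr
      (.inr (.inr ⟨f, hsub i hf, g, hsub j hg, hfg, rfl⟩))))))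

/-- Let `𝓐 = (A_1,…,A_t)` be a list of irreducible bases and
`𝓔 = (E_1,…,E_t)` with nonempty `E_i ⊆ A_i`, such that any two distinct elements of
`A = ⋃ᵢ Aᵢ` are relatively prime.  Then, after discarding integer constants and
identifying resultants that differ only by sign, the McCallum projection `P(𝓡)` of the
ResCAD set equals the TTICAD projection `P_𝓔(𝓐)`. -/
theorem resCAD_projection_eq_tticad_projection
    (k t : ℕ) (A E : Fin t → Finset (Polynomial (Rk k)))
    (hA : ∀ i, IsIrredBasis (A i))
    (hE : ∀ i, (E i).Nonempty ∧ E i ⊆ A i)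
    (hrel : ∀ f ∈ Finset.univ.biUnion A, ∀ g ∈ Finset.univ.biUnion A,
      f ≠ g → IsRelPrime f g) :
    ∀ x : Rk k, (¬ ∃ c : ℤ, x = MvPolynomial.C c) →
      ((x ∈ projResCAD A E → (x ∈ projTTI A E ∨ -x ∈ projTTI A E)) ∧
       (x ∈ projTTI A E → (x ∈ projResCAD A E ∨ -x ∈ projResCAD A E))) := by
  intro x hx
  refine ⟨mem_projTTI_or_neg_of_mem_projResCAD (fun i f hf => ?_) hx,
    mem_projResCAD_or_neg_of_mem_projTTI⟩
  obtain ⟨hdeg, hirr⟩ := (hA i).1 f ((hE i).2 hf)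
  exact hirr.isPrimitive hdeg.ne'

end
end
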